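/- arXiv:1211.5642 — 8 statements merged into one kernel-verified Lean document; each statement's English description precedes it below -/
import Mathlib

section
/- Let A be a symmetric nonnegative tensor of order k and dimension n, and suppose λ is the greatest H-eigenvalue of A (i.e., λ is an H-eigenvalue of A and every H-eigenvalue μ of A satisfies μ ≤ λ). Then λ is the maximum of the set {A x^k : x ∈ ℝ^n, x ≥ 0 componentwise, ∑_{i=1}^n x_i^k = 1}; that is, A x^k ≤ λ for every such x, and λ = A y^k for some y ≥ 0 with ∑_{i=1}^n y_i^k = 1. -/
open Finset

/-- `A x^k = ∑_{i₁,…,i_k} a_{i₁…i_k} x_{i₁}⋯x_{i_k}`. -/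
def tApply (k n : ℕ) (A : (Fin k → Fin n) → ℝ) (x : Fin n → ℝ) : ℝ :=
  ∑ f : Fin k → Fin n, A f * ∏ j : Fin k, x (f j)

/-- The `i`-th component of `A x^{k-1}`:
`∑_{i₂,…,i_k} a_{i i₂…i_k} x_{i₂}⋯x_{i_k}`. -/
def tApplyVec (k n : ℕ) (hk : 2 ≤ k) (A : (Fin k → Fin n) → ℝ) (x : Fin n → ℝ)
    (i : Fin n) : ℝ :=
  ∑ f ∈ Finset.univ.filter (fun f : Fin k → Fin n => f ⟨0, by omega⟩ = i),
    A f * ∏ j ∈ Finset.univ.erase (⟨0, by omega⟩ : Fin k), x (f j)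

/-- A tensor is symmetric if its entries are invariant under permutations of the indices. -/
def IsSymmTensor (k n : ℕ) (A : (Fin k → Fin n) → ℝ) : Prop :=
  ∀ (σ : Equiv.Perm (Fin k)) (f : Fin k → Fin n), A (f ∘ σ) = A f

/-- `lam` is an H-eigenvalue of `A`: there is a real `x ≠ 0` with `A x^{k-1} = lam x^{[k-1]}`. -/
def IsHEigenvalue (k n : ℕ) (hk : 2 ≤ k) (A : (Fin k → Fin n) → ℝ) (lam : ℝ) : Prop :=
  ∃ x : Fin n → ℝ, x ≠ 0 ∧ ∀ i : Fin n, tApplyVec k n hk A x i = lam * x i ^ (k - 1)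

/-- The `i`-th row sum `R_i(A) = ∑_{i₂,…,i_k} a_{i i₂…i_k}`. -/
def rowSum (k n : ℕ) (hk : 2 ≤ k) (A : (Fin k → Fin n) → ℝ) (i : Fin n) : ℝ :=
  ∑ f ∈ Finset.univ.filter (fun f : Fin k → Fin n => f ⟨0, by omega⟩ = i), A f


lemma aux_hom (k n : ℕ) (A : (Fin k → Fin n) → ℝ) (c : ℝ) (x : Fin n → ℝ) :
    tApply k n A (fun i => c * x i) = c ^ k * tApply k n A x := by
  unfold tApply
  rw [Finset.mul_sum]
  refine Finset.sum_congr rfl fun f _ => ?_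
  rw [Finset.prod_mul_distrib]
  simp
  ring

lemma aux_euler (k n : ℕ) (hk : 2 ≤ k) (A : (Fin k → Fin n) → ℝ) (x : Fin n → ℝ) :
    ∑ i, x i * tApplyVec k n hk A x i = tApply k n A x := by
  unfold tApply tApplyVec
  rw [← Finset.sum_fiberwise (s := Finset.univ) (g := fun f : Fin k → Fin n => f ⟨0, by omega⟩)]
  refine Finset.sum_congr rfl fun i _ => ?_
  rw [Finset.mul_sum]
  refine Finset.sum_congr rfl fun f hf => ?_
  have hf' : f ⟨0, by omega⟩ = i := by simpa using hf
  rw [← Finset.mul_prod_erase Finset.univ (fun j => x (f j)) (Finset.mem_univ ⟨0, by omega⟩), hf']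
  ring

lemma aux_swap (k n : ℕ) (hk : 2 ≤ k) (A : (Fin k → Fin n) → ℝ) (hsym : IsSymmTensor k n A)
    (x : Fin n → ℝ) (i : Fin n) (j : Fin k) :
    ∑ f : Fin k → Fin n, A f * ((∏ l ∈ Finset.univ.erase j, x (f l)) * (if f j = i then 1 else 0))
      = tApplyVec k n hk A x i := by
  unfold tApplyVec
  rw [Finset.sum_filter]
  set z : Fin k := ⟨0, by omega⟩ with hz
  refine Fintype.sum_equiv (Equiv.arrowCongr (Equiv.swap z j) (Equiv.refl _)) _ _ fun f => ?_
  have h1 : (Equiv.arrowCongr (Equiv.swap z j) (Equiv.refl (Fin n))) f = f ∘ (Equiv.swap z j) := by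
    ext l; simp [Equiv.arrowCongr]
  rw [h1, hsym]
  have h2 : ∏ l ∈ Finset.univ.erase z, x ((f ∘ (Equiv.swap z j)) l)
      = ∏ l ∈ Finset.univ.erase j, x (f l) := by
    refine Finset.prod_bij (fun l _ => Equiv.swap z j l) ?_ ?_ ?_ ?_
    · intro l hl
      simp only [Finset.mem_erase, Finset.mem_univ, and_true] at hl ⊢
      intro h
      apply hl
      have := congrArg (Equiv.swap z j) h
      simpa using this
    · intro a _ b _ h
      exact (Equiv.swap z j).injective h
    · intro l hl
      simp only [Finset.mem_erase, Finset.mem_univ, and_true] at hl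
      refine ⟨Equiv.swap z j l, ?_, by simp⟩
      simp only [Finset.mem_erase, Finset.mem_univ, and_true]
      intro h
      apply hl
      have := congrArg (Equiv.swap z j) h
      simpa using this
    · intro l _
      rfl
  rw [h2]
  simp [Function.comp]

lemma aux_deriv (k n : ℕ) (hk : 2 ≤ k) (A : (Fin k → Fin n) → ℝ) (hsym : IsSymmTensor k n A)
    (x : Fin n → ℝ) (i : Fin n) :
    HasDerivAt (fun t : ℝ => tApply k n A (fun l => x l + t * (if l = i then 1 else 0)))
      (k * tApplyVec k n hk A x i) 0 := by
  have hl : ∀ l : Fin n, HasDerivAt (fun t : ℝ => x l + t * (if l = i then (1:ℝ) else 0))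
      (if l = i then (1:ℝ) else 0) 0 := by
    intro l
    simpa using ((hasDerivAt_id (0:ℝ)).mul_const (if l = i then (1:ℝ) else 0)).const_add (x l)
  have hp : ∀ f : Fin k → Fin n, HasDerivAt
      (fun t : ℝ => A f * ∏ j : Fin k, (x (f j) + t * (if f j = i then (1:ℝ) else 0)))
      (A f * ∑ j : Fin k, ((∏ l ∈ Finset.univ.erase j, x (f l)) * (if f j = i then 1 else 0))) 0 := by
    intro f
    have := (HasDerivAt.fun_finsetProd (u := Finset.univ) (x := (0:ℝ))
      (f := fun (j : Fin k) (t : ℝ) => (x (f j) + t * (if f j = i then (1:ℝ) else 0)))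
      (f' := fun j => if f j = i then (1:ℝ) else 0) (fun j _ => hl (f j))).const_mul (A f)
    simpa only [zero_mul, add_zero, smul_eq_mul] using this
  have hs := HasDerivAt.fun_sum (u := Finset.univ) (fun f _ => hp f)
  unfold tApply
  refine hs.congr_deriv ?_
  simp_rw [Finset.mul_sum]
  rw [Finset.sum_comm]
  rw [Finset.sum_congr rfl (fun j _ => aux_swap k n hk A hsym x i j)]
  simp

lemma aux_deriv_pow (k n : ℕ) (x : Fin n → ℝ) (i : Fin n) :
    HasDerivAt (fun t : ℝ => ∑ l, (x l + t * (if l = i then (1:ℝ) else 0)) ^ k)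
      (k * x i ^ (k - 1)) 0 := by
  have hl : ∀ l : Fin n, HasDerivAt (fun t : ℝ => (x l + t * (if l = i then (1:ℝ) else 0)) ^ k)
      (k * x l ^ (k - 1) * (if l = i then (1:ℝ) else 0)) 0 := by
    intro l
    have h := ((hasDerivAt_id (0:ℝ)).mul_const (if l = i then (1:ℝ) else 0)).const_add (x l)
    simpa using h.fun_pow k
  have hs := HasDerivAt.fun_sum (u := Finset.univ) (fun l _ => hl l)
  refine hs.congr_deriv ?_
  simp

lemma aux_right (g : ℝ → ℝ) (d : ℝ) (h : HasDerivAt g d 0) (h0 : g 0 = 0)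
    (hg : ∀ t, 0 ≤ t → 0 ≤ g t) : 0 ≤ d := by
  have h1 := (hasDerivWithinAt_iff_tendsto_slope' (by simp)).1 (h.hasDerivWithinAt (s := Set.Ioi 0))
  refine ge_of_tendsto h1 ?_
  filter_upwards [self_mem_nhdsWithin] with t ht
  have ht' : 0 < t := ht
  rw [slope_def_field, h0]
  have := hg t ht'.le
  simp only [sub_zero]
  positivity

lemma aux_max (k n : ℕ) (hk : 2 ≤ k) (hn : 1 ≤ n) (A : (Fin k → Fin n) → ℝ) :
    ∃ y : Fin n → ℝ, (∀ i, 0 ≤ y i) ∧ ∑ i, y i ^ k = 1 ∧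
      ∀ x : Fin n → ℝ, (∀ i, 0 ≤ x i) → ∑ i : Fin n, x i ^ k = 1 →
        tApply k n A x ≤ tApply k n A y := by
  have hk0 : k ≠ 0 := by omega
  let S : Set (Fin n → ℝ) := {x | (∀ i, 0 ≤ x i) ∧ ∑ i, x i ^ k = 1}
  have hclosed : IsClosed S := by
    have h1 : IsClosed {x : Fin n → ℝ | ∀ i, 0 ≤ x i} := by
      simp only [Set.ofPred_forall]
      exact isClosed_iInter fun i => isClosed_le continuous_const (continuous_apply i)
    have h2 : IsClosed {x : Fin n → ℝ | ∑ i, x i ^ k = 1} :=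
      isClosed_eq (by fun_prop) continuous_const
    exact h1.inter h2
  have hcpt : IsCompact S := by
    refine IsCompact.of_isClosed_subset (isCompact_Icc (a := (0 : Fin n → ℝ)) (b := 1)) hclosed ?_
    rintro x ⟨hx, hs⟩
    refine ⟨hx, fun i => ?_⟩
    have : x i ^ k ≤ 1 := by
      rw [← hs]
      exact Finset.single_le_sum (f := fun i => x i ^ k) (fun j _ => pow_nonneg (hx j) k)
        (Finset.mem_univ i)
    exact (pow_le_one_iff_of_nonneg (hx i) hk0).1 this
  have hne : S.Nonempty := by
    refine ⟨fun i => if i = ⟨0, by omega⟩ then 1 else 0, fun i => ?_, ?_⟩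
    · dsimp only
      split_ifs <;> norm_num
    · simp [ite_pow, hk0]
  have hcont : Continuous (tApply k n A) := by
    unfold tApply
    fun_prop
  obtain ⟨y, hy, hmax⟩ := hcpt.exists_isMaxOn hne hcont.continuousOn
  exact ⟨y, hy.1, hy.2, fun x h1 h2 => hmax ⟨h1, h2⟩⟩

lemma aux_bound (k n : ℕ) (hk : 2 ≤ k) (A : (Fin k → Fin n) → ℝ) (M : ℝ)
    (hM : ∀ x : Fin n → ℝ, (∀ i, 0 ≤ x i) → ∑ i : Fin n, x i ^ k = 1 → tApply k n A x ≤ M)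
    (x : Fin n → ℝ) (hx : ∀ i, 0 ≤ x i) : tApply k n A x ≤ M * ∑ i, x i ^ k := by
  have hk0 : k ≠ 0 := by omega
  have hs0 : 0 ≤ ∑ i, x i ^ k := Finset.sum_nonneg fun i _ => pow_nonneg (hx i) k
  rcases hs0.eq_or_lt with h | h
  · have hz : ∀ i, x i = 0 := by
      intro i
      have := (Finset.sum_eq_zero_iff_of_nonneg (fun i _ => pow_nonneg (hx i) k)).1 h.symm i
        (Finset.mem_univ i)
      exact eq_zero_of_pow_eq_zero this
    rw [← h, mul_zero]
    unfold tApply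
    refine (Finset.sum_eq_zero fun f _ => ?_).le
    rw [Finset.prod_eq_zero (Finset.mem_univ (⟨0, by omega⟩ : Fin k)) (hz _), mul_zero]
  · set s := ∑ i, x i ^ k with hs
    set c : ℝ := s ^ ((k : ℝ)⁻¹) with hc
    have hcpos : 0 < c := Real.rpow_pos_of_pos h _
    have hck : c ^ k = s := Real.rpow_inv_natCast_pow h.le hk0
    have h1 := hM (fun i => c⁻¹ * x i) (fun i => mul_nonneg (inv_nonneg.2 hcpos.le) (hx i)) (by
      simp_rw [mul_pow]
      rw [← Finset.mul_sum, ← hs, inv_pow, hck, inv_mul_cancel₀ h.ne'])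
    rw [aux_hom, inv_pow, hck, inv_mul_le_iff₀ h] at h1
    linarith

lemma aux_eig (k n : ℕ) (hk : 2 ≤ k) (A : (Fin k → Fin n) → ℝ) (hsym : IsSymmTensor k n A)
    (hnn : ∀ f : Fin k → Fin n, 0 ≤ A f) (y : Fin n → ℝ) (hy : ∀ i, 0 ≤ y i)
    (hy1 : ∑ i, y i ^ k = 1)
    (hM : ∀ x : Fin n → ℝ, (∀ i, 0 ≤ x i) → tApply k n A x ≤ tApply k n A y * ∑ i, x i ^ k) :
    IsHEigenvalue k n hk A (tApply k n A y) := by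
  refine ⟨y, ?_, fun i => ?_⟩
  · rintro rfl
    have : k ≠ 0 := by omega
    simp [this] at hy1
  · set M := tApply k n A y with hMdef
    have hd := ((aux_deriv_pow k n y i).const_mul M).sub (aux_deriv k n hk A hsym y i)
    set g : ℝ → ℝ := (fun t : ℝ => M * ∑ l, (y l + t * (if l = i then (1:ℝ) else 0)) ^ k) -
      (fun t : ℝ => tApply k n A (fun l => y l + t * (if l = i then 1 else 0))) with hg
    have hg0 : g 0 = 0 := by
      simp only [hg, Pi.sub_apply, zero_mul, add_zero, hy1]
      rw [hMdef]; ring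
    have hgn : ∀ t, 0 ≤ y i + t → 0 ≤ g t := by
      intro t ht
      simp only [hg, Pi.sub_apply]
      refine sub_nonneg.2 (hM _ fun l => ?_)
      by_cases hl : l = i
      · subst hl; simpa using ht
      · simpa [hl] using hy l
    have hkpos : (0:ℝ) < k := by
      have : 0 < k := by omega
      exact_mod_cast this
    rcases (hy i).eq_or_lt with h | h
    · have h1 := aux_right g _ hd hg0 (fun t ht => hgn t (by linarith))
      have h2 : y i ^ (k - 1) = 0 := by rw [← h]; exact zero_pow (by omega)
      have h3 : 0 ≤ tApplyVec k n hk A y i :=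
        Finset.sum_nonneg fun f _ => mul_nonneg (hnn f) (Finset.prod_nonneg fun j _ => hy _)
      rw [h2] at h1 ⊢
      nlinarith
    · have hmin : IsLocalMin g 0 := by
        filter_upwards [Ioi_mem_nhds (show -y i < 0 by linarith)] with t ht
        rw [hg0]
        have ht' : -y i < t := ht
        exact hgn t (by linarith)
      have h1 := hmin.hasDerivAt_eq_zero hd
      have h2 : (k:ℝ) * (M * y i ^ (k - 1) - tApplyVec k n hk A y i) = 0 := by linarith
      have := (mul_eq_zero.1 h2).resolve_left hkpos.ne'
      linarith

lemma aux_le (k n : ℕ) (hk : 2 ≤ k) (A : (Fin k → Fin n) → ℝ)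
    (hnn : ∀ f : Fin k → Fin n, 0 ≤ A f) (M : ℝ)
    (hM : ∀ x : Fin n → ℝ, (∀ i, 0 ≤ x i) → tApply k n A x ≤ M * ∑ i, x i ^ k)
    (lam : ℝ) (hlam : IsHEigenvalue k n hk A lam) : lam ≤ M := by
  obtain ⟨x, hx0, hx⟩ := hlam
  have hpos : 0 < ∑ i, |x i| ^ k := by
    obtain ⟨i, hi⟩ := Function.ne_iff.1 hx0
    exact Finset.sum_pos' (fun j _ => by positivity)
      ⟨i, Finset.mem_univ i, pow_pos (abs_pos.2 hi) k⟩
  have h1 : |lam| * ∑ i, |x i| ^ k ≤ tApply k n A (fun i => |x i|) := by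
    rw [← aux_euler k n hk, Finset.mul_sum]
    refine Finset.sum_le_sum fun i _ => ?_
    have h2 : |x i| ^ k = |x i| * |x i| ^ (k - 1) := by
      rw [← pow_succ']; congr 1; omega
    have h3 : |lam| * |x i| ^ (k - 1) = |tApplyVec k n hk A x i| := by
      rw [hx i, abs_mul, abs_pow]
    have h4 : |tApplyVec k n hk A x i| ≤ tApplyVec k n hk A (fun i => |x i|) i := by
      unfold tApplyVec
      refine (Finset.abs_sum_le_sum_abs _ _).trans (Finset.sum_le_sum fun f _ => ?_)
      rw [abs_mul, abs_of_nonneg (hnn f), Finset.abs_prod]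
    calc |lam| * |x i| ^ k = |x i| * (|lam| * |x i| ^ (k - 1)) := by rw [h2]; ring
      _ ≤ _ := by rw [h3]; exact mul_le_mul_of_nonneg_left h4 (abs_nonneg _)
  have h5 := h1.trans (hM _ fun i => abs_nonneg _)
  exact (le_abs_self lam).trans (le_of_mul_le_mul_right h5 hpos)

/-- maximum property of the largest H-eigenvalue of a symmetric
nonnegative tensor. -/
theorem max_heigenvalue_of_symm_nonneg (k n : ℕ) (hk : 2 ≤ k) (hn : 1 ≤ n)
    (A : (Fin k → Fin n) → ℝ) (hsym : IsSymmTensor k n A)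
    (hnn : ∀ f : Fin k → Fin n, 0 ≤ A f)
    (lam : ℝ) (hlam : IsHEigenvalue k n hk A lam)
    (hmax : ∀ mu : ℝ, IsHEigenvalue k n hk A mu → mu ≤ lam) :
    (∀ x : Fin n → ℝ, (∀ i, 0 ≤ x i) → ∑ i : Fin n, x i ^ k = 1 →
      tApply k n A x ≤ lam) ∧
    ∃ y : Fin n → ℝ, (∀ i, 0 ≤ y i) ∧ ∑ i : Fin n, y i ^ k = 1 ∧
      tApply k n A y = lam := by
  obtain ⟨y, hy, hy1, hM⟩ := aux_max k n hk hn A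
  have hb := aux_bound k n hk A _ hM
  have h1 := hmax _ (aux_eig k n hk A hsym hnn y hy hy1 hb)
  have h2 := aux_le k n hk A hnn _ hb lam hlam
  exact ⟨fun x hx hx1 => (hM x hx hx1).trans h1, y, hy, hy1, le_antisymm h1 h2⟩
end

section
/- If A is a nonnegative tensor of order k and dimension n, then every H-eigenvalue λ of A satisfies λ ≤ R_max(A), the largest row sum of A. -/
open Finset

/-- every H-eigenvalue of a nonnegative tensor is at most the
largest row sum. -/
theorem heigenvalue_le_max_rowSum (k n : ℕ) (hk : 2 ≤ k) (hn : 1 ≤ n)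
    (A : (Fin k → Fin n) → ℝ) (hnn : ∀ f : Fin k → Fin n, 0 ≤ A f)
    (lam : ℝ) (hlam : IsHEigenvalue k n hk A lam) :
    lam ≤ Finset.univ.sup'
      (⟨(⟨0, by omega⟩ : Fin n), Finset.mem_univ _⟩ : (Finset.univ : Finset (Fin n)).Nonempty)
      (rowSum k n hk A) := by
  obtain ⟨x, hx0, hx⟩ := hlam
  obtain ⟨i, -, hi⟩ := Finset.exists_max_image (Finset.univ : Finset (Fin n)) (fun i => |x i|)
    ⟨⟨0, by omega⟩, Finset.mem_univ _⟩
  have hpos : 0 < |x i| := by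
    obtain ⟨j, hj⟩ := Function.ne_iff.mp hx0
    exact lt_of_lt_of_le (abs_pos.mpr hj) (hi j (Finset.mem_univ _))
  refine le_trans ?_ (Finset.le_sup' (rowSum k n hk A) (Finset.mem_univ i))
  have hp : 0 < |x i| ^ (k - 1) := pow_pos hpos _
  refine le_of_mul_le_mul_right ?_ hp
  calc lam * |x i| ^ (k - 1) ≤ |lam| * |x i| ^ (k - 1) :=
        mul_le_mul_of_nonneg_right (le_abs_self _) hp.le
    _ = |tApplyVec k n hk A x i| := by rw [hx i, abs_mul, abs_pow]
    _ ≤ rowSum k n hk A i * |x i| ^ (k - 1) := by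
        unfold tApplyVec rowSum
        rw [Finset.sum_mul]
        refine (Finset.abs_sum_le_sum_abs _ _).trans (Finset.sum_le_sum fun f _ => ?_)
        rw [abs_mul, abs_of_nonneg (hnn f), Finset.abs_prod]
        refine mul_le_mul_of_nonneg_left ?_ (hnn f)
        refine (Finset.prod_le_prod (fun _ _ => abs_nonneg _)
          (fun j _ => hi (f j) (Finset.mem_univ _))).trans (le_of_eq ?_)
        rw [Finset.prod_const, Finset.card_erase_of_mem (Finset.mem_univ _), Finset.card_univ,
          Fintype.card_fin]
end

section
/- A symmetric nonnegative tensor A of order k and dimension n has at most one H⁺⁺-eigenvalue: if λ and μ are real numbers each of which is an H-eigenvalue of A possessing an H-eigenvector with all components strictly positive, then λ = μ. -/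
open Finset

theorem weighted_sum_aux (k n : ℕ) (hk : 2 ≤ k) (A : (Fin k → Fin n) → ℝ) (x w : Fin n → ℝ) :
    ∑ f : Fin k → Fin n, A f * (∏ j, x (f j)) * w (f ⟨0, by omega⟩)
      = ∑ i, w i * x i * tApplyVec k n hk A x i := by
  rw [← Finset.sum_fiberwise (s := Finset.univ) (g := fun f : Fin k → Fin n => f ⟨0, by omega⟩)]
  refine Finset.sum_congr rfl fun i _ => ?_
  unfold tApplyVec
  rw [Finset.mul_sum]
  refine Finset.sum_congr rfl fun f hf => ?_
  have hf' : f ⟨0, by omega⟩ = i := (Finset.mem_filter.mp hf).2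
  rw [← Finset.mul_prod_erase Finset.univ (fun j => x (f j))
    (Finset.mem_univ (⟨0, by omega⟩ : Fin k)), hf']
  ring

theorem symm_sum_aux (k n : ℕ) (A : (Fin k → Fin n) → ℝ) (hsym : IsSymmTensor k n A)
    (x w : Fin n → ℝ) (a b : Fin k) :
    ∑ f : Fin k → Fin n, A f * (∏ j, x (f j)) * w (f a)
      = ∑ f : Fin k → Fin n, A f * (∏ j, x (f j)) * w (f b) := by
  refine Fintype.sum_equiv (Equiv.arrowCongr (Equiv.swap a b) (Equiv.refl _)) _ _ fun f => ?_
  have h1 : (Equiv.arrowCongr (Equiv.swap a b) (Equiv.refl (Fin n))) f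
      = f ∘ (Equiv.swap a b) := by
    ext j; simp [Equiv.arrowCongr]
  rw [h1, hsym]
  have h2 : ∏ j, x ((f ∘ (Equiv.swap a b)) j) = ∏ j, x (f j) :=
    Equiv.prod_comp (Equiv.swap a b) (fun j => x (f j))
  rw [h2]
  simp

theorem amgm_aux (k : ℕ) (hk : 2 ≤ k) (t : Fin k → ℝ) (ht : ∀ j, 0 ≤ t j) :
    (k : ℝ) * ∏ j, t j ≤ ∑ j, t j ^ k := by
  have hk0 : (0 : ℝ) < k := by exact_mod_cast (by omega : 0 < k)
  have h := Real.geom_mean_le_arith_mean_weighted Finset.univ (fun _ : Fin k => (k : ℝ)⁻¹)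
    (fun j => t j ^ k) (fun _ _ => by positivity) (by simp [hk0.ne'])
    (fun j _ => pow_nonneg (ht j) k)
  have h1 : ∀ j, (t j ^ k) ^ ((k : ℝ)⁻¹) = t j := fun j =>
    Real.pow_rpow_inv_natCast (ht j) (by omega)
  simp only [h1] at h
  rw [← Finset.mul_sum] at h
  calc (k : ℝ) * ∏ j, t j ≤ k * ((k : ℝ)⁻¹ * ∑ j, t j ^ k) := by gcongr
    _ = _ := by field_simp

theorem hpp_le_aux (k n : ℕ) (hk : 2 ≤ k) (hn : 1 ≤ n)
    (A : (Fin k → Fin n) → ℝ) (hsym : IsSymmTensor k n A)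
    (hnn : ∀ f : Fin k → Fin n, 0 ≤ A f) (lam mu : ℝ) (x y : Fin n → ℝ)
    (hx : ∀ i, 0 < x i) (hy : ∀ i, 0 < y i)
    (hlam : ∀ i : Fin n, tApplyVec k n hk A x i = lam * x i ^ (k - 1))
    (hmu : ∀ i : Fin n, tApplyVec k n hk A y i = mu * y i ^ (k - 1)) : mu ≤ lam := by
  have hk0 : (0 : ℝ) < k := by exact_mod_cast (by omega : 0 < k)
  have hp : ∀ z : ℝ, z * z ^ (k - 1) = z ^ k := fun z => mul_pow_sub_one (by omega) z
  have e1 : ∑ f : Fin k → Fin n, A f * (∏ j, y (f j)) = mu * ∑ i, y i ^ k := by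
    have h := weighted_sum_aux k n hk A y (fun _ => 1)
    simp only [mul_one, one_mul] at h
    rw [h, Finset.mul_sum]
    refine Finset.sum_congr rfl fun i _ => ?_
    rw [hmu, ← hp]; ring
  have e2 : ∀ a : Fin k, ∑ f : Fin k → Fin n, A f * (∏ j, x (f j)) * (y (f a) / x (f a)) ^ k
      = lam * ∑ i, y i ^ k := by
    intro a
    rw [symm_sum_aux k n A hsym x (fun i => (y i / x i) ^ k) a ⟨0, by omega⟩,
      weighted_sum_aux k n hk A x (fun i => (y i / x i) ^ k), Finset.mul_sum]
    refine Finset.sum_congr rfl fun i _ => ?_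
    rw [hlam, mul_assoc, mul_left_comm (x i), hp, div_pow]
    have := (hx i).ne'
    field_simp
  have e3 : (k : ℝ) * ∑ f : Fin k → Fin n, A f * (∏ j, y (f j))
      ≤ ∑ a : Fin k, ∑ f : Fin k → Fin n,
        A f * (∏ j, x (f j)) * (y (f a) / x (f a)) ^ k := by
    rw [Finset.sum_comm, Finset.mul_sum]
    refine Finset.sum_le_sum fun f _ => ?_
    rw [← Finset.mul_sum]
    have h := amgm_aux k hk (fun j => y (f j) / x (f j)) (fun j => (div_pos (hy _) (hx _)).le)
    have hX : 0 < ∏ j, x (f j) := Finset.prod_pos fun j _ => hx _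
    have h3 : ∏ j, y (f j) = (∏ j, x (f j)) * ∏ j, (y (f j) / x (f j)) := by
      rw [Finset.prod_div_distrib]; field_simp
    calc (k : ℝ) * (A f * ∏ j, y (f j))
        = A f * (∏ j, x (f j)) * (k * ∏ j, (y (f j) / x (f j))) := by rw [h3]; ring
      _ ≤ _ := mul_le_mul_of_nonneg_left h (mul_nonneg (hnn f) hX.le)
  rw [e1, Finset.sum_congr rfl (fun a _ => e2 a)] at e3
  simp only [Finset.sum_const, Finset.card_univ, Fintype.card_fin, nsmul_eq_mul] at e3
  have hS : 0 < ∑ i, y i ^ k :=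
    Finset.sum_pos (fun i _ => pow_pos (hy i) k) ⟨⟨0, hn⟩, Finset.mem_univ _⟩
  exact le_of_mul_le_mul_right (le_of_mul_le_mul_left e3 hk0) hS

/-- a symmetric nonnegative tensor has at most one H⁺⁺-eigenvalue. -/
theorem hpp_eigenvalue_unique (k n : ℕ) (hk : 2 ≤ k) (hn : 1 ≤ n)
    (A : (Fin k → Fin n) → ℝ) (hsym : IsSymmTensor k n A)
    (hnn : ∀ f : Fin k → Fin n, 0 ≤ A f)
    (lam mu : ℝ)
    (hlam : ∃ x : Fin n → ℝ, x ≠ 0 ∧ (∀ i, 0 < x i) ∧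
      ∀ i : Fin n, tApplyVec k n hk A x i = lam * x i ^ (k - 1))
    (hmu : ∃ x : Fin n → ℝ, x ≠ 0 ∧ (∀ i, 0 < x i) ∧
      ∀ i : Fin n, tApplyVec k n hk A x i = mu * x i ^ (k - 1)) :
    lam = mu := by
  obtain ⟨x, -, hx, hlx⟩ := hlam
  obtain ⟨y, -, hy, hmy⟩ := hmu
  exact le_antisymm (hpp_le_aux k n hk hn A hsym hnn mu lam y x hy hx hmy hlx)
    (hpp_le_aux k n hk hn A hsym hnn lam mu x y hx hy hlx hmy)
end

section
/- Let A be a symmetric nonnegative tensor of order k and dimension n. If λ is an H-eigenvalue of A having an H-eigenvector all of whose components are strictly positive, then λ is the largest H-eigenvalue of A: every H-eigenvalue μ of A satisfies μ ≤ λ. -/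
open Finset

/-- an H-eigenvalue of a symmetric nonnegative tensor with a strictly
positive H-eigenvector is the largest H-eigenvalue. -/
theorem hpp_eigenvalue_is_max (k n : ℕ) (hk : 2 ≤ k) (hn : 1 ≤ n)
    (A : (Fin k → Fin n) → ℝ) (hsym : IsSymmTensor k n A)
    (hnn : ∀ f : Fin k → Fin n, 0 ≤ A f)
    (lam : ℝ)
    (hlam : ∃ x : Fin n → ℝ, x ≠ 0 ∧ (∀ i, 0 < x i) ∧
      ∀ i : Fin n, tApplyVec k n hk A x i = lam * x i ^ (k - 1)) :
    ∀ mu : ℝ, IsHEigenvalue k n hk A mu → mu ≤ lam := by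
  obtain ⟨x, -, hx, hxe⟩ := hlam
  rintro mu ⟨y, hy, hye⟩
  have hne : (Finset.univ : Finset (Fin n)).Nonempty := ⟨⟨0, hn⟩, Finset.mem_univ _⟩
  obtain ⟨i, -, hi⟩ := Finset.exists_max_image Finset.univ (fun j => |y j| / x j) hne
  obtain ⟨c, hc⟩ : ∃ c, c = |y i| / x i := ⟨_, rfl⟩
  have hle : ∀ j, |y j| ≤ c * x j := by
    intro j
    have := hi j (Finset.mem_univ j)
    rw [hc]
    exact (div_le_iff₀ (hx j)).1 this
  have heq : |y i| = c * x i := by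
    rw [hc]
    exact (div_mul_cancel₀ _ (hx i).ne').symm
  have hyi : 0 < |y i| := by
    obtain ⟨j, hj⟩ := Function.ne_iff.1 hy
    have h1 : 0 < |y j| := abs_pos.2 hj
    have h2 : 0 < c := by
      by_contra h
      have := mul_nonpos_of_nonpos_of_nonneg (not_lt.1 h) (hx j).le
      linarith [hle j]
    rw [heq]
    exact mul_pos h2 (hx i)
  have key : |tApplyVec k n hk A y i| ≤ c ^ (k - 1) * tApplyVec k n hk A x i := by
    unfold tApplyVec
    rw [Finset.mul_sum]
    refine (Finset.abs_sum_le_sum_abs _ _).trans (Finset.sum_le_sum fun f _ => ?_)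
    rw [abs_mul, abs_of_nonneg (hnn f), Finset.abs_prod, mul_left_comm]
    refine mul_le_mul_of_nonneg_left ?_ (hnn f)
    refine (Finset.prod_le_prod (fun j _ => abs_nonneg _) (fun j _ => hle (f j))).trans ?_
    rw [Finset.prod_mul_distrib]
    simp
  rw [hye, hxe, abs_mul, abs_pow, mul_left_comm, ← mul_pow, ← heq] at key
  exact (le_abs_self mu).trans (le_of_mul_le_mul_right key (pow_pos hyi _))
end

section
/- If A is an essentially nonpositive tensor of order k and dimension n, then every H-eigenvalue λ of A satisfies λ ≥ R_min(A), the smallest row sum of A. -/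
open Finset

/-- every H-eigenvalue of an essentially nonpositive tensor is at
least the smallest row sum. -/
theorem heigenvalue_ge_min_rowSum (k n : ℕ) (hk : 2 ≤ k) (hn : 1 ≤ n)
    (A : (Fin k → Fin n) → ℝ)
    (hess : ∀ f : Fin k → Fin n, (¬ ∃ i : Fin n, ∀ j : Fin k, f j = i) → A f ≤ 0)
    (lam : ℝ) (hlam : IsHEigenvalue k n hk A lam) :
    Finset.univ.inf'
      (⟨(⟨0, by omega⟩ : Fin n), Finset.mem_univ _⟩ : (Finset.univ : Finset (Fin n)).Nonempty)
      (rowSum k n hk A) ≤ lam := by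
  obtain ⟨x, hx, hE⟩ := hlam
  obtain ⟨i, -, hi⟩ := Finset.exists_max_image (Finset.univ : Finset (Fin n)) (fun i => |x i|)
    ⟨(⟨0, by omega⟩ : Fin n), Finset.mem_univ _⟩
  have hxi : x i ≠ 0 := by
    intro h0
    apply hx
    funext j
    have := hi j (Finset.mem_univ _)
    simp only [h0, abs_zero] at this
    exact abs_nonpos_iff.mp this
  refine (Finset.inf'_le _ (Finset.mem_univ i)).trans ?_
  have hcard : (Finset.univ.erase (⟨0, by omega⟩ : Fin k)).card = k - 1 := by
    simp
  set y := x i ^ (k - 1) with hy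
  have hy0 : y ≠ 0 := pow_ne_zero _ hxi
  have key : rowSum k n hk A i * (y * y) ≤ lam * (y * y) := by
    rw [← mul_assoc lam, ← hE i, rowSum, tApplyVec, Finset.sum_mul, Finset.sum_mul]
    apply Finset.sum_le_sum
    intro f hf
    have hf0 := (Finset.mem_filter.mp hf).2
    rw [mul_assoc]
    by_cases hd : ∃ i : Fin n, ∀ j : Fin k, f j = i
    · obtain ⟨m, hm⟩ := hd
      have hmi : m = i := by rw [← hf0, hm]
      subst hmi
      simp only [hm, Finset.prod_const, hcard]
      exact le_refl _
    · apply mul_le_mul_of_nonpos_left _ (hess f hd)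
      have hP : |∏ j ∈ Finset.univ.erase (⟨0, by omega⟩ : Fin k), x (f j)| ≤ |y| := by
        rw [Finset.abs_prod, hy, abs_pow, ← hcard, ← Finset.prod_const]
        exact Finset.prod_le_prod (fun _ _ => abs_nonneg _)
          (fun j _ => hi (f j) (Finset.mem_univ _))
      calc _ ≤ |(∏ j ∈ Finset.univ.erase (⟨0, by omega⟩ : Fin k), x (f j)) * y| := le_abs_self _
        _ ≤ |y| * |y| := by
          rw [abs_mul]
          exact mul_le_mul_of_nonneg_right hP (abs_nonneg _)
        _ = y * y := abs_mul_abs_self y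
  exact le_of_mul_le_mul_right key (mul_self_pos.mpr hy0)
end

section
/- Let A be a symmetric, essentially nonpositive tensor of order k and dimension n. If every row sum of A is nonnegative, i.e., R_i(A) ≥ 0 for i = 1,…,n, then A is copositive. -/
open Finset

/-- a symmetric, essentially nonpositive tensor all of whose row
sums are nonnegative is copositive. -/
theorem copositive_of_ess_nonpos_rowSum_nonneg (k n : ℕ) (hk : 2 ≤ k) (hn : 1 ≤ n)
    (A : (Fin k → Fin n) → ℝ) (hsym : IsSymmTensor k n A)
    (hess : ∀ f : Fin k → Fin n, (¬ ∃ i : Fin n, ∀ j : Fin k, f j = i) → A f ≤ 0)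
    (hrow : ∀ i : Fin n, 0 ≤ rowSum k n hk A i) :
    ∀ x : Fin n → ℝ, (∀ i, 0 ≤ x i) → 0 ≤ tApply k n A x := by
  intro x hx
  have hk0 : k ≠ 0 := by omega
  have hkR : (k : ℝ) ≠ 0 := by exact_mod_cast hk0
  have amgm : ∀ f : Fin k → Fin n,
      ∏ j : Fin k, x (f j) ≤ ∑ j : Fin k, (k : ℝ)⁻¹ * x (f j) ^ k := by
    intro f
    have h := Real.geom_mean_le_arith_mean_weighted (Finset.univ : Finset (Fin k))
      (fun _ => (k : ℝ)⁻¹) (fun j => x (f j) ^ k) (fun _ _ => by positivity)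
      (by simp [hkR]) (fun j _ => pow_nonneg (hx _) _)
    refine le_trans (le_of_eq ?_) h
    exact Finset.prod_congr rfl fun j _ => (Real.pow_rpow_inv_natCast (hx _) hk0).symm
  have term : ∀ f : Fin k → Fin n,
      A f * (∑ j : Fin k, (k : ℝ)⁻¹ * x (f j) ^ k) ≤ A f * ∏ j : Fin k, x (f j) := by
    intro f
    by_cases hf : ∃ i : Fin n, ∀ j : Fin k, f j = i
    · obtain ⟨i, hi⟩ := hf
      apply le_of_eq
      simp only [hi, Finset.sum_const, Finset.prod_const, Finset.card_univ, Fintype.card_fin,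
        nsmul_eq_mul]
      field_simp
    · exact mul_le_mul_of_nonpos_left (amgm f) (hess f hf)
  have base : 0 ≤ ∑ f : Fin k → Fin n, A f * x (f ⟨0, by omega⟩) ^ k := by
    rw [← Finset.sum_fiberwise (Finset.univ : Finset (Fin k → Fin n))
      (fun f => f ⟨0, by omega⟩)]
    refine Finset.sum_nonneg fun i _ => ?_
    have h : 0 ≤ rowSum k n hk A i * x i ^ k := mul_nonneg (hrow i) (pow_nonneg (hx i) k)
    rw [rowSum, Finset.sum_mul] at h
    refine le_trans h (le_of_eq (Finset.sum_congr rfl fun f hf => ?_))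
    rw [(Finset.mem_filter.mp hf).2]
  have all : ∀ j : Fin k, 0 ≤ ∑ f : Fin k → Fin n, A f * x (f j) ^ k := by
    intro j
    refine le_trans base (le_of_eq ?_)
    refine Fintype.sum_equiv
      (Equiv.arrowCongr (Equiv.swap (⟨0, by omega⟩ : Fin k) j) (Equiv.refl (Fin n))) _ _ ?_
    intro f
    have e : (Equiv.arrowCongr (Equiv.swap (⟨0, by omega⟩ : Fin k) j) (Equiv.refl (Fin n))) f
        = f ∘ (Equiv.swap (⟨0, by omega⟩ : Fin k) j) := by
      ext a
      simp [Equiv.arrowCongr]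
    rw [e, hsym]
    simp
  calc (0 : ℝ) ≤ ∑ j : Fin k, (k : ℝ)⁻¹ * ∑ f : Fin k → Fin n, A f * x (f j) ^ k :=
        Finset.sum_nonneg fun j _ => mul_nonneg (by positivity) (all j)
    _ = ∑ f : Fin k → Fin n, A f * (∑ j : Fin k, (k : ℝ)⁻¹ * x (f j) ^ k) := by
        simp only [Finset.mul_sum]
        rw [Finset.sum_comm]
        refine Finset.sum_congr rfl fun f _ => Finset.sum_congr rfl fun j _ => ?_
        ring
    _ ≤ tApply k n A x := Finset.sum_le_sum fun f _ => term f
end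

section
/- Let A be a copositive tensor of order k and dimension n. If x ∈ ℝ^n satisfies x ≥ 0 componentwise and A x^k = 0, then A x^{k-1} ≥ 0 componentwise, i.e., (A x^{k-1})_i ≥ 0 for every i = 1,…,n. -/
open Finset

theorem hasDerivAt_tApply (k n : ℕ) (hk : 2 ≤ k)
    (A : (Fin k → Fin n) → ℝ) (hsym : IsSymmTensor k n A)
    (x : Fin n → ℝ) (i : Fin n) :
    HasDerivAt (fun t : ℝ => tApply k n A (fun m => x m + t * (if m = i then 1 else 0)))
      (k * tApplyVec k n hk A x i) 0 := by
  have h1 : HasDerivAt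
      (fun t : ℝ => tApply k n A (fun m => x m + t * (if m = i then 1 else 0)))
      (∑ f : Fin k → Fin n, A f * ∑ j : Fin k,
        (∏ l ∈ Finset.univ.erase j, x (f l)) * (if f j = i then 1 else 0)) 0 := by
    unfold tApply
    refine HasDerivAt.fun_sum fun f _ => HasDerivAt.const_mul _ ?_
    have h2 : ∀ j ∈ (Finset.univ : Finset (Fin k)),
        HasDerivAt (fun t : ℝ => x (f j) + t * (if f j = i then 1 else 0))
          (if f j = i then 1 else 0) 0 := by
      intro j _
      simpa using ((hasDerivAt_id (0 : ℝ)).mul_const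
        (if f j = i then (1 : ℝ) else 0)).const_add (x (f j))
    have h3 := HasDerivAt.fun_finset_prod h2
    simpa only [zero_mul, add_zero, smul_eq_mul] using h3
  convert h1 using 1
  simp_rw [Finset.mul_sum]
  rw [Finset.sum_comm]
  have key : ∀ j : Fin k, ∑ f : Fin k → Fin n, A f *
      ((∏ l ∈ Finset.univ.erase j, x (f l)) * (if f j = i then 1 else 0))
      = tApplyVec k n hk A x i := by
    intro j
    unfold tApplyVec
    rw [Finset.sum_filter]
    set z : Fin k := ⟨0, by omega⟩ with hz
    refine Fintype.sum_equiv (Equiv.arrowCongr (Equiv.swap z j) (Equiv.refl _)) _ _ fun f => ?_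
    have e : (Equiv.arrowCongr (Equiv.swap z j) (Equiv.refl (Fin n))) f
        = f ∘ Equiv.swap z j := by
      ext l; simp [Equiv.arrowCongr]
    rw [e, hsym]
    have e2 : ∏ l ∈ Finset.univ.erase z, x ((f ∘ Equiv.swap z j) l)
        = ∏ l ∈ Finset.univ.erase j, x (f l) := by
      refine Finset.prod_equiv (Equiv.swap z j) (fun l => ?_) (fun l _ => rfl)
      simp [Equiv.swap_apply_eq_iff]
    rw [e2]
    simp
  rw [Finset.sum_congr rfl fun j _ => key j]
  simp

/-- if `A` is copositive, `x ≥ 0` and `A x^k = 0`, then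
`A x^{k-1} ≥ 0` componentwise. -/
theorem grad_nonneg_of_copositive_zero (k n : ℕ) (hk : 2 ≤ k) (hn : 1 ≤ n)
    (A : (Fin k → Fin n) → ℝ) (hsym : IsSymmTensor k n A)
    (hcop : ∀ x : Fin n → ℝ, (∀ i, 0 ≤ x i) → 0 ≤ tApply k n A x)
    (x : Fin n → ℝ) (hx : ∀ i, 0 ≤ x i) (hzero : tApply k n A x = 0) :
    ∀ i : Fin n, 0 ≤ tApplyVec k n hk A x i := by
  intro i
  have hd := hasDerivAt_tApply k n hk A hsym x i
  have hk0 : (0 : ℝ) < k := by exact_mod_cast (by omega : 0 < k)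
  have hlim := hd.tendsto_slope_zero_right
  have h0 : 0 ≤ (k : ℝ) * tApplyVec k n hk A x i := by
    refine ge_of_tendsto hlim ?_
    filter_upwards [self_mem_nhdsWithin] with t ht
    have ht' : (0 : ℝ) < t := ht
    simp only [zero_add, zero_mul, add_zero, smul_eq_mul, hzero, sub_zero]
    refine mul_nonneg (inv_nonneg.2 ht'.le) (hcop _ fun m => ?_)
    have := hx m
    positivity
  exact nonneg_of_mul_nonneg_right h0 hk0
end

section
/- Within the space S_{k,n} of real symmetric tensors of order k and dimension n (with its standard finite-dimensional topology), the set SC_{k,n} of strictly copositive tensors is exactly the interior of the set C_{k,n} of copositive tensors: a symmetric tensor A is strictly copositive if and only if A lies in the interior of C_{k,n} relative to S_{k,n}. -/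
open Finset

/-- within the space of symmetric tensors, the strictly copositive
tensors are exactly the interior of the copositive tensors. -/
theorem strictly_copositive_iff_mem_interior (k n : ℕ) (hk : 2 ≤ k) (hn : 1 ≤ n)
    (A : (Fin k → Fin n) → ℝ) (hA : IsSymmTensor k n A) :
    (∀ x : Fin n → ℝ, (∀ i, 0 ≤ x i) → x ≠ 0 → 0 < tApply k n A x) ↔
    (⟨A, hA⟩ : {B : (Fin k → Fin n) → ℝ // IsSymmTensor k n B}) ∈
      interior {B : {B : (Fin k → Fin n) → ℝ // IsSymmTensor k n B} |
        ∀ x : Fin n → ℝ, (∀ i, 0 ≤ x i) → 0 ≤ tApply k n B.1 x} := by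
  have hpos : ∀ x : Fin n → ℝ, (∀ i, 0 ≤ x i) → x ≠ 0 → 0 < ∑ i, x i := by
    intro x hx hx0
    obtain ⟨i, hi⟩ := Function.ne_iff.mp hx0
    exact Finset.sum_pos' (fun i _ => hx i)
      ⟨i, Finset.mem_univ i, lt_of_le_of_ne (hx i) (Ne.symm hi)⟩
  have hsmul : ∀ (B : (Fin k → Fin n) → ℝ) (s : ℝ) (x : Fin n → ℝ),
      tApply k n B (fun i => s * x i) = s ^ k * tApply k n B x := by
    intro B s x
    unfold tApply
    rw [Finset.mul_sum]
    refine Finset.sum_congr rfl fun f _ => ?_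
    rw [Finset.prod_mul_distrib, Finset.prod_const, Finset.card_univ, Fintype.card_fin]
    ring
  constructor
  · intro h
    rw [mem_interior_iff_mem_nhds]
    have hK : IsCompact (stdSimplex ℝ (Fin n)) := isCompact_stdSimplex ℝ (Fin n)
    have hcont : Continuous (fun p : {B : (Fin k → Fin n) → ℝ // IsSymmTensor k n B} ×
        (Fin n → ℝ) => tApply k n p.1.1 p.2) := by
      unfold tApply
      refine continuous_finsetSum _ fun f _ => Continuous.mul ?_ ?_
      · exact (continuous_apply f).comp (continuous_subtype_val.comp continuous_fst)
      · exact continuous_finsetProd _ fun j _ => (continuous_apply (f j)).comp continuous_snd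
    have hev := hK.eventually_forall_of_forall_eventually
      (x₀ := (⟨A, hA⟩ : {B : (Fin k → Fin n) → ℝ // IsSymmTensor k n B}))
      (P := fun B x => 0 < tApply k n B.1 x) (by
        intro x hx
        refine hcont.continuousAt.eventually_const_lt (h x hx.1 ?_)
        rintro rfl
        simpa using hx.2)
    filter_upwards [hev] with B hB x hx
    by_cases hx0 : x = 0
    · subst hx0
      have h0 := hsmul B.1 0 0
      rw [zero_pow (by omega), zero_mul] at h0
      have e : (fun i : Fin n => (0:ℝ) * (0 : Fin n → ℝ) i) = 0 := by ext; simp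
      rw [e] at h0
      exact h0.ge
    · have hs := hpos x hx hx0
      have hy := hB (fun i => (∑ i, x i)⁻¹ * x i)
        ⟨fun i => mul_nonneg (inv_nonneg.mpr hs.le) (hx i), by
          rw [← Finset.mul_sum]; exact inv_mul_cancel₀ hs.ne'⟩
      rw [hsmul] at hy
      exact (pos_of_mul_pos_right hy (by positivity)).le
  · intro h x hx hx0
    rw [mem_interior_iff_mem_nhds] at h
    let g : ℝ → {B : (Fin k → Fin n) → ℝ // IsSymmTensor k n B} :=
      fun t => ⟨fun f => A f - t, fun σ f => by simp only [hA σ f]⟩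
    have hg : Continuous g := by
      refine Continuous.subtype_mk ?_ _
      fun_prop
    have hg0 : g 0 = ⟨A, hA⟩ := by
      apply Subtype.ext; ext f; simp [g]
    rw [← hg0] at h
    have hev := hg.continuousAt.preimage_mem_nhds h
    obtain ⟨ε, hε, hb⟩ := Metric.mem_nhds_iff.mp hev
    have hmem : ε / 2 ∈ Metric.ball (0:ℝ) ε := by
      rw [Metric.mem_ball, Real.dist_eq, sub_zero, abs_of_pos (by positivity)]
      linarith
    have h1 : 0 ≤ tApply k n (fun f => A f - ε / 2) x := hb hmem x hx
    have h2 : tApply k n (fun f => A f - ε / 2) x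
        = tApply k n A x - ε / 2 * (∑ i, x i) ^ k := by
      unfold tApply
      have : (∑ i, x i) ^ k = ∑ f : Fin k → Fin n, ∏ j, x (f j) := by
        rw [Fintype.sum_pow]
      rw [this, Finset.mul_sum, ← Finset.sum_sub_distrib]
      exact Finset.sum_congr rfl fun f _ => by ring
    have h3 : 0 < ε / 2 * (∑ i, x i) ^ k := mul_pos (by positivity) (pow_pos (hpos x hx hx0) k)
    linarith
end
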